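/- There exists an absolute constant C > 0 such that for every domain size n, every ε ∈ (0,1], every α ∈ [0,1], every known distribution q on [n] and every prediction distribution p̂ on [n], with d := tv(q − p̂), there exists an (α, ε, 0.1)-augmented identity tester (valid for all unknown distributions p on [n]) whose number of samples s satisfies: s ≤ C·√n/ε² if d ≤ α, and s ≤ C·min(1/(d−α)², √n/ε²) if d > α. -/

import Mathlib

open Finset

/-- The three possible outputs of an augmented tester. -/
inductive Outcome where
  | accept
  | reject
  | inaccurate
deriving DecidableEq

instance : Fintype Outcome where
  elems := {Outcome.accept, Outcome.reject, Outcome.inaccurate}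
  complete := by intro x; cases x <;> decide

/-- `p` is a probability distribution on `Fin n`. -/
def IsDist {n : ℕ} (p : Fin n → ℝ) : Prop :=
  (∀ i, 0 ≤ p i) ∧ ∑ i, p i = 1

/-- Total variation distance `(1/2)·Σᵢ |pᵢ − qᵢ|`. -/
noncomputable def tv {n : ℕ} (p q : Fin n → ℝ) : ℝ :=
  (∑ i, |p i - q i|) / 2

/-- Probability that the randomized algorithm `A`, fed `s` i.i.d. samples from `p`,
outputs outcome `o`. -/
noncomputable def outProb {n s : ℕ} (p : Fin n → ℝ)
    (A : (Fin s → Fin n) → Outcome → ℝ) (o : Outcome) : ℝ :=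
  ∑ x : Fin s → Fin n, (∏ j, p (x j)) * A x o

/-- `A` is a randomized algorithm: on each sample sequence it outputs a probability
distribution over the three outcomes. -/
def IsRandomizedAlg {n s : ℕ} (A : (Fin s → Fin n) → Outcome → ℝ) : Prop :=
  (∀ x o, 0 ≤ A x o) ∧ ∀ x, ∑ o, A x o = 1

/-- `A` is an `(α, ε, δ)`-augmented identity tester for the known distribution `q`
with prediction `phat`, using `s` i.i.d. samples from the unknown distribution `p`. -/
def IsAugIdentityTester {n s : ℕ} (α ε δ : ℝ) (q phat : Fin n → ℝ)
    (A : (Fin s → Fin n) → Outcome → ℝ) : Prop :=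
  IsRandomizedAlg A ∧
  ∀ p : Fin n → ℝ, IsDist p →
    (tv phat p ≤ α → outProb p A Outcome.inaccurate ≤ δ / 2) ∧
    (p = q → outProb p A Outcome.reject ≤ δ / 2) ∧
    (ε < tv p q → outProb p A Outcome.accept ≤ δ / 2)

/-- Expectation of `F` over `s` i.i.d. samples from `p`. -/
noncomputable def iidExpect {n : ℕ} (p : Fin n → ℝ) (s : ℕ) (F : (Fin s → Fin n) → ℝ) : ℝ :=
  ∑ x : Fin s → Fin n, (∏ j, p (x j)) * F x

section Expectation

variable {n : ℕ} {p : Fin n → ℝ}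

lemma iidExpect_succ (s : ℕ) (F : (Fin (s + 1) → Fin n) → ℝ) :
    iidExpect p (s + 1) F = ∑ i, p i * iidExpect p s (fun x => F (Fin.cons i x)) := by
  unfold iidExpect
  rw [← (Fin.consEquiv (fun _ : Fin (s + 1) => Fin n)).sum_comp, Fintype.sum_prod_type]
  refine Finset.sum_congr rfl fun i _ => ?_
  rw [Finset.mul_sum]
  refine Finset.sum_congr rfl fun x _ => ?_
  simp [Fin.consEquiv, Fin.prod_univ_succ, mul_assoc]

lemma iidExpect_add {s : ℕ} (F G : (Fin s → Fin n) → ℝ) :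
    iidExpect p s (fun x => F x + G x) = iidExpect p s F + iidExpect p s G := by
  simp [iidExpect, mul_add, Finset.sum_add_distrib]

lemma iidExpect_const_mul {s : ℕ} (c : ℝ) (F : (Fin s → Fin n) → ℝ) :
    iidExpect p s (fun x => c * F x) = c * iidExpect p s F := by
  simp only [iidExpect, Finset.mul_sum]
  exact Finset.sum_congr rfl fun x _ => by ring

lemma iidExpect_sum {s : ℕ} {ι : Type*} (t : Finset ι) (F : ι → (Fin s → Fin n) → ℝ) :
    iidExpect p s (fun x => ∑ i ∈ t, F i x) = ∑ i ∈ t, iidExpect p s (F i) := by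
  simp only [iidExpect, Finset.mul_sum]
  exact Finset.sum_comm

lemma iidExpect_const (hp : IsDist p) (s : ℕ) (c : ℝ) :
    iidExpect p s (fun _ => c) = c := by
  induction s with
  | zero => simp [iidExpect]
  | succ s ih => rw [iidExpect_succ]; simp only [ih, ← Finset.sum_mul, hp.2, one_mul]

lemma iidExpect_mono (hp : IsDist p) {s : ℕ} {F G : (Fin s → Fin n) → ℝ}
    (h : ∀ x, F x ≤ G x) : iidExpect p s F ≤ iidExpect p s G :=
  Finset.sum_le_sum fun x _ =>
    mul_le_mul_of_nonneg_left (h x) (Finset.prod_nonneg fun j _ => hp.1 (x j))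

lemma iidExpect_append_mul (s t : ℕ) (F : (Fin s → Fin n) → ℝ) (G : (Fin t → Fin n) → ℝ) :
    iidExpect p (s + t) (fun x => F (fun j => x (Fin.castAdd t j)) * G (fun j => x (Fin.natAdd s j)))
      = iidExpect p s F * iidExpect p t G := by
  unfold iidExpect
  rw [← (Fin.appendEquiv s t).sum_comp, Fintype.sum_prod_type, Finset.sum_mul_sum]
  refine Finset.sum_congr rfl fun x _ => Finset.sum_congr rfl fun y _ => ?_
  simp only [Fin.appendEquiv, Equiv.coe_fn_mk, Fin.prod_univ_add, Fin.append_left, Fin.append_right]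
  ring

lemma iidExpect_sum_apply (hp : IsDist p) (s : ℕ) (f : Fin n → ℝ) :
    iidExpect p s (fun x => ∑ j, f (x j)) = s * ∑ i, p i * f i := by
  induction s with
  | zero => simp [iidExpect]
  | succ s ih =>
    rw [iidExpect_succ]
    simp only [Fin.sum_univ_succ, Fin.cons_zero, Fin.cons_succ]
    simp only [iidExpect_add, iidExpect_const hp, ih, mul_add, Finset.sum_add_distrib,
      ← Finset.sum_mul, hp.2]
    push_cast
    ring

lemma iidExpect_sum_apply_mul_sum_apply (hp : IsDist p) (s : ℕ) (f g : Fin n → ℝ) :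
    iidExpect p s (fun x => (∑ j, f (x j)) * ∑ j, g (x j)) =
      s * ∑ i, p i * (f i * g i) + s * (s - 1) * ((∑ i, p i * f i) * ∑ i, p i * g i) := by
  induction s with
  | zero => simp [iidExpect]
  | succ s ih =>
    rw [iidExpect_succ]
    have key : ∀ i, iidExpect p s (fun x => (∑ j, f ((Fin.cons i x : Fin (s + 1) → Fin n) j)) *
          ∑ j, g ((Fin.cons i x : Fin (s + 1) → Fin n) j)) =
        f i * g i + f i * (s * ∑ i, p i * g i) + g i * (s * ∑ i, p i * f i) +
          iidExpect p s (fun x => (∑ j, f (x j)) * ∑ j, g (x j)) := by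
      intro i
      rw [← iidExpect_sum_apply hp, ← iidExpect_sum_apply hp, ← iidExpect_const_mul,
        ← iidExpect_const_mul, ← iidExpect_const hp s (f i * g i), ← iidExpect_add,
        ← iidExpect_add, ← iidExpect_add]
      congr 1
      funext x
      simp only [Fin.sum_univ_succ, Fin.cons_zero, Fin.cons_succ]
      ring
    simp only [key, ih]
    have e : ∀ i c d k : ℝ, ∀ a b : ℝ, i * (a * b + a * c + b * d + k) =
        i * (a * b) + (i * a) * c + (i * b) * d + i * k := by intros; ring
    simp only [e, Finset.sum_add_distrib, ← Finset.sum_mul, hp.2]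
    push_cast
    ring

/-- Chebyshev's inequality for a `[0, 1]`-valued test. -/
lemma iidExpect_le_of_sq_dev (hp : IsDist p) {s : ℕ} {B T : (Fin s → Fin n) → ℝ} {c t : ℝ}
    (ht : 0 < t) (hB : ∀ x, B x ≤ 1) (hB' : ∀ x, 0 < B x → t ≤ |T x - c|) :
    iidExpect p s B ≤ iidExpect p s (fun x => (T x - c) ^ 2) / t ^ 2 := by
  rw [div_eq_inv_mul, ← iidExpect_const_mul]
  refine iidExpect_mono hp fun x => ?_
  rcases le_or_gt (B x) 0 with h | h
  · exact h.trans (by positivity)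
  · refine (hB x).trans ?_
    rw [← div_eq_inv_mul, one_le_div (by positivity), ← sq_abs (T x - c)]
    exact pow_le_pow_left₀ ht.le (hB' x h) 2

end Expectation

section Scheffe

variable {n : ℕ}

lemma iidExpect_mean_sub_sq_le {p : Fin n → ℝ} (hp : IsDist p) {s : ℕ} (hs : 0 < s)
    (S : Finset (Fin n)) :
    iidExpect p s (fun x => ((∑ j, if x j ∈ S then (1 : ℝ) else 0) / s - ∑ i ∈ S, p i) ^ 2)
      ≤ 1 / s := by
  set f : Fin n → ℝ := fun i => if i ∈ S then 1 else 0
  have hs' : (0 : ℝ) < s := by exact_mod_cast hs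
  have hf : ∑ i, p i * f i = ∑ i ∈ S, p i := by simp [f]
  have hff : ∑ i, p i * (f i * f i) = ∑ i ∈ S, p i := by simp [f]
  set P := ∑ i ∈ S, p i
  have e : (fun x : Fin s → Fin n => ((∑ j, f (x j)) / s - P) ^ 2) = fun x =>
      (1 / (s : ℝ) ^ 2) * ((∑ j, f (x j)) * ∑ j, f (x j)) +
        ((-(2 * P / s)) * (∑ j, f (x j)) + P ^ 2) := by
    funext x; field_simp; ring
  change iidExpect p s (fun x => ((∑ j, f (x j)) / s - P) ^ 2) ≤ _
  rw [e, iidExpect_add, iidExpect_add, iidExpect_const_mul, iidExpect_const_mul,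
    iidExpect_const hp, iidExpect_sum_apply hp, iidExpect_sum_apply_mul_sum_apply hp, hf, hff]
  have hP : P ≤ 1 := hp.2 ▸ Finset.sum_le_univ_sum_of_nonneg hp.1
  have : 1 / (s : ℝ) ^ 2 * (s * P + s * (s - 1) * (P * P)) + (-(2 * P / s) * (s * P) + P ^ 2)
      = (P - P ^ 2) / s := by field_simp; ring
  rw [this]
  gcongr
  nlinarith [sq_nonneg P]

lemma exists_sum_sub_sum_eq_tv {p q : Fin n → ℝ} (hp : IsDist p) (hq : IsDist q) :
    ∃ S : Finset (Fin n), ∑ i ∈ S, q i - ∑ i ∈ S, p i = tv p q := by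
  refine ⟨univ.filter fun i => p i ≤ q i, ?_⟩
  have h0 : ∑ i, (q i - p i) = 0 := by rw [Finset.sum_sub_distrib, hp.2, hq.2, sub_self]
  have h1 : ∑ i, |p i - q i| = ∑ i, (2 * (if p i ≤ q i then q i - p i else 0) - (q i - p i)) := by
    refine Finset.sum_congr rfl fun i _ => ?_
    split_ifs with h
    · rw [abs_of_nonpos (by linarith)]; ring
    · rw [abs_of_pos (by linarith)]; ring
  rw [tv, h1, Finset.sum_sub_distrib, h0, ← Finset.mul_sum, ← Finset.sum_filter,
    Finset.sum_sub_distrib]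
  ring

lemma tv_comm (p q : Fin n → ℝ) : tv p q = tv q p := by simp only [tv, abs_sub_comm]

lemma sum_sub_sum_le_tv {p q : Fin n → ℝ} (hp : IsDist p) (hq : IsDist q) (S : Finset (Fin n)) :
    ∑ i ∈ S, q i - ∑ i ∈ S, p i ≤ tv p q := by
  have h0 : ∑ i, (q i - p i) = 0 := by rw [Finset.sum_sub_distrib, hp.2, hq.2, sub_self]
  have h1 : ∑ i, (2 * (if i ∈ S then q i - p i else 0) - (q i - p i)) ≤ ∑ i, |p i - q i| := by
    refine Finset.sum_le_sum fun i _ => ?_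
    split_ifs
    · linarith [neg_abs_le (p i - q i)]
    · linarith [le_abs_self (p i - q i)]
  rw [Finset.sum_sub_distrib, h0, ← Finset.mul_sum, Finset.sum_ite_mem, Finset.univ_inter,
    Finset.sum_sub_distrib] at h1
  rw [tv]
  linarith

lemma tv_le_one {p q : Fin n → ℝ} (hp : IsDist p) (hq : IsDist q) : tv p q ≤ 1 := by
  obtain ⟨S, hS⟩ := exists_sum_sub_sum_eq_tv hp hq
  have h1 : ∑ i ∈ S, q i ≤ 1 := hq.2 ▸ Finset.sum_le_univ_sum_of_nonneg hq.1
  have h2 : 0 ≤ ∑ i ∈ S, p i := Finset.sum_nonneg fun i _ => hp.1 i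
  linarith

/-- The deterministic algorithm that outputs `g x` on samples `x`. -/
def detAlg {s : ℕ} (g : (Fin s → Fin n) → Outcome) (x : Fin s → Fin n) (o : Outcome) : ℝ :=
  if g x = o then 1 else 0

lemma isRandomizedAlg_detAlg {s : ℕ} (g : (Fin s → Fin n) → Outcome) :
    IsRandomizedAlg (detAlg g) := by
  refine ⟨fun x o => ?_, fun x => ?_⟩
  · unfold detAlg; split_ifs <;> norm_num
  · simp [detAlg]

lemma outProb_detAlg_le {p : Fin n → ℝ} (hp : IsDist p) {s : ℕ}
    {g : (Fin s → Fin n) → Outcome} {o : Outcome} {T : (Fin s → Fin n) → ℝ} {c t : ℝ}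
    (ht : 0 < t) (h : ∀ x, g x = o → t ≤ |T x - c|) :
    outProb p (detAlg g) o ≤ iidExpect p s (fun x => (T x - c) ^ 2) / t ^ 2 := by
  refine iidExpect_le_of_sq_dev (B := fun x => detAlg g x o) hp ht (fun x => ?_) fun x hx => h x ?_
  · unfold detAlg; split_ifs <;> norm_num
  · by_contra hne
    simp [detAlg, hne] at hx

lemma outProb_detAlg_eq_zero {p : Fin n → ℝ} {s : ℕ} {g : (Fin s → Fin n) → Outcome}
    {o : Outcome} (h : ∀ x, g x ≠ o) : outProb p (detAlg g) o = 0 := by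
  simp [outProb, detAlg, h]

lemma exists_tester_of_lt_tv {ε α : ℝ} {q phat : Fin n → ℝ} (hq : IsDist q) (hphat : IsDist phat)
    (hα : 0 ≤ α) (hd : α < tv q phat) :
    ∃ (s : ℕ) (A : (Fin s → Fin n) → Outcome → ℝ),
      IsAugIdentityTester α ε 0.1 q phat A ∧ (s : ℝ) ≤ 1000 * (1 / (tv q phat - α) ^ 2) := by
  obtain ⟨S, hS⟩ := exists_sum_sub_sum_eq_tv hq hphat
  have hd1 := tv_le_one hq hphat
  set η := tv q phat - α with hη
  have hη0 : 0 < η := by linarith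
  set s := ⌈80 / η ^ 2⌉₊ with hs
  have hs1 : 80 / η ^ 2 ≤ s := Nat.le_ceil _
  have hs2 : (s : ℝ) < 80 / η ^ 2 + 1 := Nat.ceil_lt_add_one (by positivity)
  have hs0 : 0 < s := Nat.ceil_pos.2 (by positivity)
  have hs0' : (0 : ℝ) < s := by exact_mod_cast hs0
  let T : (Fin s → Fin n) → ℝ := fun x => (∑ j, if x j ∈ S then (1 : ℝ) else 0) / s
  let g : (Fin s → Fin n) → Outcome := fun x =>
    if ∑ i ∈ S, q i + η / 2 ≤ T x then Outcome.reject else Outcome.inaccurate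
  have hbound : ∀ p : Fin n → ℝ, IsDist p → ∀ o,
      (∀ x, g x = o → η / 2 ≤ |T x - ∑ i ∈ S, p i|) → outProb p (detAlg g) o ≤ 0.1 / 2 := by
    intro p hp o ho
    refine (outProb_detAlg_le hp (half_pos hη0) ho).trans ?_
    rw [div_le_iff₀ (by positivity)]
    refine (iidExpect_mean_sub_sq_le hp hs0 S).trans ?_
    rw [div_le_iff₀ hs0']
    rw [div_le_iff₀ (by positivity)] at hs1
    nlinarith
  refine ⟨s, detAlg g, ⟨isRandomizedAlg_detAlg g, fun p hp => ⟨fun h => ?_, fun h => ?_, fun _ => ?_⟩⟩,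
    ?_⟩
  · refine hbound p hp _ fun x hx => ?_
    have hx' : T x < ∑ i ∈ S, q i + η / 2 := by
      by_contra hc
      simp [g, not_lt.1 hc] at hx
    have := sum_sub_sum_le_tv hp hphat S
    rw [tv_comm] at this
    have h2 := neg_abs_le (T x - ∑ i ∈ S, p i)
    linarith
  · refine hbound p hp _ fun x hx => ?_
    have hx' : ∑ i ∈ S, q i + η / 2 ≤ T x := by
      by_contra hc
      simp [g, hc] at hx
    rw [h]
    have h2 := le_abs_self (T x - ∑ i ∈ S, q i)
    linarith
  · rw [outProb_detAlg_eq_zero]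
    · norm_num
    · intro x
      simp only [g]
      split_ifs <;> simp
  · have : 1 ≤ 1 / η ^ 2 := by
      rw [one_le_div (by positivity)]
      nlinarith
    have h3 : 80 / η ^ 2 = 80 * (1 / η ^ 2) := by ring
    linarith

end Scheffe

section ChiSquare

variable {n : ℕ}

/-- Deviation of the empirical frequency of `i` from `q i`. -/
noncomputable def freqDev {m : ℕ} (q : Fin n → ℝ) (i : Fin n) (x : Fin m → Fin n) : ℝ :=
  (∑ j, ((if x j = i then (1 : ℝ) else 0) - q i)) / m

/-- Unbiased estimator of `∑ i, (p i - q i) ^ 2 * v i` from two independent batches. -/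
noncomputable def chiSqStat {m : ℕ} (q v : Fin n → ℝ) (x : Fin (m + m) → Fin n) : ℝ :=
  ∑ i, v i * (freqDev q i (fun j => x (Fin.castAdd m j)) *
    freqDev q i (fun j => x (Fin.natAdd m j)))

variable {p q : Fin n → ℝ}

lemma iidExpect_freqDev (hp : IsDist p) {m : ℕ} (hm : 0 < m) (i : Fin n) :
    iidExpect p m (freqDev q i) = p i - q i := by
  have hm' : (m : ℝ) ≠ 0 := by positivity
  have e : (freqDev q i : (Fin m → Fin n) → ℝ) = fun x =>
      (1 / (m : ℝ)) * ∑ j, (fun y => (if y = i then (1 : ℝ) else 0) - q i) (x j) := by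
    funext x; simp only [freqDev]; ring
  rw [e, iidExpect_const_mul,
    iidExpect_sum_apply hp m fun y => (if y = i then (1 : ℝ) else 0) - q i]
  simp only [mul_sub, Finset.sum_sub_distrib, ← Finset.sum_mul, hp.2]
  simp
  field_simp

lemma iidExpect_freqDev_mul (hp : IsDist p) {m : ℕ} (hm : 0 < m) (i k : Fin n) :
    iidExpect p m (fun x => freqDev q i x * freqDev q k x) =
      ((if i = k then p i else 0) - p i * p k) / m + (p i - q i) * (p k - q k) := by
  have hm' : (m : ℝ) ≠ 0 := by positivity
  let f : Fin n → Fin n → ℝ := fun i y => (if y = i then (1 : ℝ) else 0) - q i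
  have e : (fun x : Fin m → Fin n => freqDev q i x * freqDev q k x) = fun x =>
      (1 / (m : ℝ) ^ 2) * ((∑ j, f i (x j)) * ∑ j, f k (x j)) := by
    funext x; simp only [freqDev, f]; field_simp
  have h1 : ∀ i, ∑ y, p y * f i y = p i - q i := by
    intro i
    simp only [f, mul_sub, Finset.sum_sub_distrib, ← Finset.sum_mul, hp.2]
    simp
  have h2 : ∑ y, p y * (f i y * f k y) =
      (if i = k then p i else 0) - p i * q k - q i * p k + q i * q k := by
    have : ∀ y, p y * (f i y * f k y) = (if y = i then (if i = k then p i else 0) else 0)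
        - (if y = i then p i else 0) * q k - q i * (if y = k then p k else 0) +
          p y * (q i * q k) := by
      intro y
      simp only [f]
      by_cases h : y = i
      · subst h
        by_cases h' : y = k
        · subst h'; simp; ring
        · simp [h']; ring
      · by_cases h' : y = k
        · subst h'; simp [h]; ring
        · simp [h, h']
    simp only [this, Finset.sum_add_distrib, Finset.sum_sub_distrib, ← Finset.sum_mul,
      ← Finset.mul_sum, hp.2]
    simp
  rw [e, iidExpect_const_mul, iidExpect_sum_apply_mul_sum_apply hp, h1, h1, h2]
  field_simp
  ring

lemma iidExpect_chiSqStat (hp : IsDist p) {m : ℕ} (hm : 0 < m) (v : Fin n → ℝ) :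
    iidExpect p (m + m) (chiSqStat q v) = ∑ i, (p i - q i) ^ 2 * v i := by
  unfold chiSqStat
  rw [iidExpect_sum]
  refine Finset.sum_congr rfl fun i _ => ?_
  rw [iidExpect_const_mul, iidExpect_append_mul, iidExpect_freqDev hp hm]
  ring

lemma iidExpect_chiSqStat_sq (hp : IsDist p) {m : ℕ} (hm : 0 < m) (v : Fin n → ℝ) :
    iidExpect p (m + m) (fun x => chiSqStat q v x ^ 2) =
      ∑ i, ∑ k, v i * v k *
        (((if i = k then p i else 0) - p i * p k) / m + (p i - q i) * (p k - q k)) ^ 2 := by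
  have e : (fun x : Fin (m + m) → Fin n => chiSqStat q v x ^ 2) = fun x => ∑ i, ∑ k, v i * v k *
      ((fun y => freqDev q i y * freqDev q k y) (fun j => x (Fin.castAdd m j)) *
        (fun y => freqDev q i y * freqDev q k y) (fun j => x (Fin.natAdd m j))) := by
    funext x
    rw [chiSqStat, sq, Finset.sum_mul_sum]
    exact Finset.sum_congr rfl fun i _ => Finset.sum_congr rfl fun k _ => by ring
  rw [e, iidExpect_sum]
  refine Finset.sum_congr rfl fun i _ => ?_
  rw [iidExpect_sum]
  refine Finset.sum_congr rfl fun k _ => ?_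
  rw [iidExpect_const_mul, iidExpect_append_mul m m (fun y => freqDev q i y * freqDev q k y)
    (fun y => freqDev q i y * freqDev q k y), iidExpect_freqDev_mul hp hm]
  ring

lemma iidExpect_chiSqStat_sub_sq_le (hp : IsDist p) {m : ℕ} (hm : 0 < m) (v : Fin n → ℝ) :
    iidExpect p (m + m) (fun x => (chiSqStat q v x - ∑ i, (p i - q i) ^ 2 * v i) ^ 2) ≤
      (∑ i, (p i * v i) ^ 2) / m ^ 2 + 2 / m * ∑ i, p i * ((p i - q i) * v i) ^ 2 := by
  set D := ∑ i, (p i - q i) ^ 2 * v i with hD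
  have hm' : (0 : ℝ) < m := by exact_mod_cast hm
  have e : (fun x : Fin (m + m) → Fin n => (chiSqStat q v x - D) ^ 2) = fun x =>
      chiSqStat q v x ^ 2 + ((-(2 * D)) * chiSqStat q v x + D ^ 2) := by
    funext x; ring
  rw [e, iidExpect_add, iidExpect_add, iidExpect_const_mul, iidExpect_const hp,
    iidExpect_chiSqStat hp hm, iidExpect_chiSqStat_sq hp hm]
  have hdiag : ∀ i k, v i * v k *
        (((if i = k then p i else 0) - p i * p k) / m + (p i - q i) * (p k - q k)) ^ 2 =
      (if i = k then ((p i * v i) ^ 2 - 2 * (p i * (p i * v i) ^ 2)) / m ^ 2 +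
          2 / m * (p i * ((p i - q i) * v i) ^ 2) else 0)
        + (p i ^ 2 * v i) * (p k ^ 2 * v k) * (1 / m ^ 2)
        - (p i * (p i - q i) * v i) * (p k * (p k - q k) * v k) * (2 / m)
        + ((p i - q i) ^ 2 * v i) * ((p k - q k) ^ 2 * v k) := by
    intro i k
    by_cases h : i = k
    · subst h; simp only [if_true]; field_simp; ring
    · simp only [h, if_false]; field_simp; ring
  simp only [hdiag, Finset.sum_add_distrib, Finset.sum_sub_distrib, ← Finset.sum_mul,
    ← Finset.mul_sum, Finset.sum_ite_eq, Finset.mem_univ, if_true, ← Finset.sum_div]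
  rw [← hD]
  have hcs : (∑ i, p i ^ 2 * v i) * (∑ i, p i ^ 2 * v i) ≤ ∑ i, p i * (p i * v i) ^ 2 := by
    have := Finset.sum_sq_le_sum_mul_sum_of_sq_le_mul (R := ℝ) Finset.univ
      (r := fun i => p i ^ 2 * v i) (f := p) (g := fun i => p i * (p i * v i) ^ 2)
      (fun i _ => hp.1 i) (fun i _ => mul_nonneg (hp.1 i) (sq_nonneg _))
      (fun i _ => le_of_eq (by ring))
    rw [hp.2, one_mul, sq] at this
    exact this
  have hnn : 0 ≤ ∑ i, p i * (p i * v i) ^ 2 :=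
    Finset.sum_nonneg fun i _ => mul_nonneg (hp.1 i) (sq_nonneg _)
  set a := ∑ i, p i ^ 2 * v i
  set b := ∑ i, p i * (p i * v i) ^ 2
  set c := ∑ i, p i * (p i - q i) * v i
  set d := ∑ i, (p i * v i) ^ 2
  have h1 : a * a * (1 / (m : ℝ) ^ 2) ≤ 2 * b / m ^ 2 := by
    rw [mul_one_div]; exact div_le_div_of_nonneg_right (by linarith) (by positivity)
  have h2 : 0 ≤ c * c * (2 / (m : ℝ)) := mul_nonneg (mul_self_nonneg c) (by positivity)
  have h3 : (d - 2 * b) / (m : ℝ) ^ 2 = d / m ^ 2 - 2 * b / m ^ 2 := by ring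
  rw [h3]
  nlinarith

/-- Weights `1 / w i`, where `w` is the average of `q` and the uniform distribution. -/
noncomputable def mixWeight (q : Fin n → ℝ) (i : Fin n) : ℝ := 2 / (q i + 1 / n)

lemma mixWeight_pos (hq : IsDist q) (hn : 0 < n) (i : Fin n) : 0 < mixWeight q i := by
  have := hq.1 i
  have : (0 : ℝ) < n := by exact_mod_cast hn
  unfold mixWeight
  positivity

lemma mixWeight_le (hq : IsDist q) (hn : 0 < n) (i : Fin n) : mixWeight q i ≤ 2 * n := by
  have := hq.1 i
  have hn' : (0 : ℝ) < n := by exact_mod_cast hn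
  unfold mixWeight
  rw [div_le_iff₀ (by positivity), mul_add, mul_one_div, mul_div_assoc, div_self hn'.ne']
  have : 0 ≤ 2 * n * q i := by positivity
  linarith

lemma mul_mixWeight_le (hq : IsDist q) (hn : 0 < n) (i : Fin n) : q i * mixWeight q i ≤ 2 := by
  have := hq.1 i
  have hn' : (0 : ℝ) < n := by exact_mod_cast hn
  unfold mixWeight
  rw [← mul_div_assoc, div_le_iff₀ (by positivity)]
  have : (0 : ℝ) < 1 / n := by positivity
  linarith

lemma four_mul_tv_sq_le (hq : IsDist q) (hn : 0 < n) (p : Fin n → ℝ) :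
    4 * tv p q ^ 2 ≤ ∑ i, (p i - q i) ^ 2 * mixWeight q i := by
  have hn' : (0 : ℝ) < n := by exact_mod_cast hn
  have hw : ∑ i, (mixWeight q i)⁻¹ = 1 := by
    simp only [mixWeight, inv_div, ← Finset.sum_div, Finset.sum_add_distrib, hq.2]
    simp [hn'.ne']
  have := Finset.sum_sq_le_sum_mul_sum_of_sq_le_mul (R := ℝ) Finset.univ
      (r := fun i => |p i - q i|) (f := fun i => (mixWeight q i)⁻¹)
      (g := fun i => (p i - q i) ^ 2 * mixWeight q i)
      (fun i _ => (inv_pos.2 (mixWeight_pos hq hn i)).le)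
      (fun i _ => mul_nonneg (sq_nonneg _) (mixWeight_pos hq hn i).le)
      (fun i _ => by
        have := (mixWeight_pos hq hn i).ne'
        rw [sq_abs]; apply le_of_eq; field_simp)
  rw [hw, one_mul] at this
  rw [tv, div_pow]
  linarith

lemma sum_mul_mixWeight_sq_le (hq : IsDist q) (hn : 0 < n) (p : Fin n → ℝ) :
    ∑ i, (p i * mixWeight q i) ^ 2 ≤
      8 * n + 4 * n * ∑ i, (p i - q i) ^ 2 * mixWeight q i := by
  have : ∑ i : Fin n, (8 + 4 * n * ((p i - q i) ^ 2 * mixWeight q i)) =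
      8 * n + 4 * n * ∑ i, (p i - q i) ^ 2 * mixWeight q i := by
    rw [Finset.sum_add_distrib, Finset.mul_sum]
    simp [mul_comm]
  rw [← this]
  refine Finset.sum_le_sum fun i _ => ?_
  have hv := mixWeight_pos hq hn i
  have h1 := mixWeight_le hq hn i
  have h2 := mul_mixWeight_le hq hn i
  have h3 : 0 ≤ q i * mixWeight q i := mul_nonneg (hq.1 i) hv.le
  set v := mixWeight q i
  have h4 : (q i * v) ^ 2 ≤ 4 := by nlinarith
  have h5 : ((p i - q i) * v) ^ 2 ≤ 2 * n * ((p i - q i) ^ 2 * v) := by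
    have : ((p i - q i) * v) ^ 2 = v * ((p i - q i) ^ 2 * v) := by ring
    rw [this]
    gcongr
  have h6 : p i * v = q i * v + (p i - q i) * v := by ring
  rw [h6]
  nlinarith [sq_nonneg (q i * v - (p i - q i) * v)]

lemma sum_mul_sub_mul_mixWeight_sq_le (hq : IsDist q) (hn : 0 < n) (p : Fin n → ℝ) {e : ℝ}
    (he : 0 ≤ e) (hD : ∑ i, (p i - q i) ^ 2 * mixWeight q i = e ^ 2) :
    ∑ i, p i * ((p i - q i) * mixWeight q i) ^ 2 ≤ (2 + 2 * (√n * e)) * e ^ 2 := by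
  rw [← hD, Finset.mul_sum]
  refine Finset.sum_le_sum fun i _ => ?_
  have hv := mixWeight_pos hq hn i
  have h1 := mixWeight_le hq hn i
  have h2 := mul_mixWeight_le hq hn i
  have hle : (p i - q i) ^ 2 * mixWeight q i ≤ e ^ 2 := by
    rw [← hD]
    exact Finset.single_le_sum (f := fun i => (p i - q i) ^ 2 * mixWeight q i)
      (fun k _ => mul_nonneg (sq_nonneg _) (mixWeight_pos hq hn k).le) (Finset.mem_univ i)
  set v := mixWeight q i
  have h3 : (p i - q i) * v ≤ 2 * (√n * e) := by
    refine le_of_abs_le (abs_le_of_sq_le_sq ?_ (by positivity))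
    have hs : √(n : ℝ) ^ 2 = n := Real.sq_sqrt (Nat.cast_nonneg n)
    calc ((p i - q i) * v) ^ 2 = v * ((p i - q i) ^ 2 * v) := by ring
      _ ≤ (2 * n) * e ^ 2 := by gcongr
      _ ≤ (2 * (√n * e)) ^ 2 := by
        rw [mul_pow, mul_pow, hs]
        nlinarith [mul_nonneg (Nat.cast_nonneg (α := ℝ) n) (sq_nonneg e)]
  have h4 : p i * ((p i - q i) * v) ^ 2 =
      (q i * v + (p i - q i) * v) * ((p i - q i) ^ 2 * v) := by ring
  rw [h4]
  gcongr

lemma exists_identity_tester {ε α : ℝ} (hε : ε ∈ Set.Ioc (0 : ℝ) 1) {q phat : Fin n → ℝ}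
    (hq : IsDist q) :
    ∃ (s : ℕ) (A : (Fin s → Fin n) → Outcome → ℝ),
      IsAugIdentityTester α ε 0.1 q phat A ∧ (s : ℝ) ≤ 1000 * (√n / ε ^ 2) := by
  obtain ⟨hε0, hε1⟩ := hε
  have hn : 0 < n := by
    rcases Nat.eq_zero_or_pos n with rfl | h
    · simp [IsDist] at hq
    · exact h
  have hN1 : 1 ≤ √(n : ℝ) := Real.one_le_sqrt.2 (by exact_mod_cast hn)
  have hNsq : √(n : ℝ) ^ 2 = n := Real.sq_sqrt (Nat.cast_nonneg n)
  set N := √(n : ℝ)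
  have hr1 : 1 ≤ N / ε ^ 2 := by
    rw [one_le_div (by positivity)]
    nlinarith
  set m := ⌈300 * (N / ε ^ 2)⌉₊
  have hm1 : 300 * (N / ε ^ 2) ≤ m := Nat.le_ceil _
  have hm2 : (m : ℝ) < 300 * (N / ε ^ 2) + 1 := Nat.ceil_lt_add_one (by positivity)
  have hm0 : 0 < m := Nat.ceil_pos.2 (by positivity)
  have hm0' : (0 : ℝ) < m := by exact_mod_cast hm0
  have hNm : N / m ≤ ε ^ 2 / 300 := by
    rw [← mul_div_assoc, div_le_iff₀ (by positivity)] at hm1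
    rw [div_le_div_iff₀ hm0' (by norm_num)]
    linarith
  have h1m : 1 / (m : ℝ) ≤ ε ^ 2 / 300 := le_trans (by gcongr) hNm
  have hnm : (n : ℝ) / m ^ 2 ≤ (ε ^ 2 / 300) ^ 2 := by
    rw [← hNsq, ← div_pow]
    gcongr
  let g : (Fin (m + m) → Fin n) → Outcome := fun x =>
    if chiSqStat q (mixWeight q) x < 2 * ε ^ 2 then Outcome.accept else Outcome.reject
  refine ⟨m + m, detAlg g,
    ⟨isRandomizedAlg_detAlg g, fun p hp => ⟨fun _ => ?_, fun h => ?_, fun h => ?_⟩⟩, ?_⟩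
  · rw [outProb_detAlg_eq_zero]
    · norm_num
    · intro x
      simp only [g]
      split_ifs <;> simp
  · subst h
    have hvar := iidExpect_chiSqStat_sub_sq_le (q := p) hp hm0 (mixWeight p)
    have h8 := sum_mul_mixWeight_sq_le hp hn p
    simp only [sub_self, ne_eq, OfNat.ofNat_ne_zero, not_false_eq_true, zero_pow, zero_mul,
      mul_zero, Finset.sum_const_zero, add_zero] at hvar h8
    refine (outProb_detAlg_le (T := chiSqStat p (mixWeight p)) (c := 0) (t := 2 * ε ^ 2) hp
      (by positivity) fun x hx => ?_).trans ?_
    · have hx' : 2 * ε ^ 2 ≤ chiSqStat p (mixWeight p) x := by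
        by_contra hc
        simp [g, not_le.1 hc] at hx
      rw [sub_zero]
      exact hx'.trans (le_abs_self _)
    · rw [div_le_iff₀ (by positivity)]
      refine hvar.trans ?_
      calc (∑ i, (p i * mixWeight p i) ^ 2) / (m : ℝ) ^ 2 ≤ 8 * n / m ^ 2 := by gcongr
        _ = 8 * (n / (m : ℝ) ^ 2) := by ring
        _ ≤ 8 * (ε ^ 2 / 300) ^ 2 := by gcongr
        _ ≤ 0.1 / 2 * (2 * ε ^ 2) ^ 2 := by nlinarith [pow_pos hε0 4]
  · have hvar := iidExpect_chiSqStat_sub_sq_le (q := q) hp hm0 (mixWeight q)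
    have h8 := sum_mul_mixWeight_sq_le hq hn p
    have hD := four_mul_tv_sq_le hq hn p
    set D := ∑ i, (p i - q i) ^ 2 * mixWeight q i with hDdef
    have hDε : 4 * ε ^ 2 ≤ D := by nlinarith
    have hD0 : 0 < D := lt_of_lt_of_le (by positivity) hDε
    have hesq : √D ^ 2 = D := Real.sq_sqrt hD0.le
    have he0 : 0 ≤ √D := Real.sqrt_nonneg D
    have hp2 := sum_mul_sub_mul_mixWeight_sq_le hq hn p he0 (hDdef.symm.trans hesq.symm)
    set e := √D
    rw [← hesq] at hDε h8 hvar hD0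
    have hεe : 2 * ε ≤ e := by
      refine le_of_sq_le_sq ?_ he0
      linarith
    refine (outProb_detAlg_le (T := chiSqStat q (mixWeight q)) (c := e ^ 2) (t := e ^ 2 / 2) hp
      (by positivity) fun x hx => ?_).trans ?_
    · have hx' : chiSqStat q (mixWeight q) x < 2 * ε ^ 2 := by
        by_contra hc
        simp [g, hc] at hx
      have := neg_abs_le (chiSqStat q (mixWeight q) x - e ^ 2)
      linarith
    · rw [div_le_iff₀ (by positivity)]
      refine hvar.trans ?_
      have hε2 : ε ^ 2 ≤ e ^ 2 / 4 := by linarith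
      have hε2' : ε ^ 2 ≤ e / 2 := by nlinarith
      have hA : (∑ i, (p i * mixWeight q i) ^ 2) / (m : ℝ) ^ 2 ≤ 12 * (e ^ 4 / 300 ^ 2) := by
        calc (∑ i, (p i * mixWeight q i) ^ 2) / (m : ℝ) ^ 2
            ≤ (8 * n + 4 * n * e ^ 2) / m ^ 2 := by gcongr
          _ = (8 + 4 * e ^ 2) * (n / (m : ℝ) ^ 2) := by ring
          _ ≤ (8 + 4 * e ^ 2) * (ε ^ 2 / 300) ^ 2 := by gcongr
          _ = (8 * (ε ^ 2 * ε ^ 2) + 4 * e ^ 2 * (ε ^ 2 * ε ^ 2)) / 300 ^ 2 := by ring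
          _ ≤ (8 * ((e ^ 2 / 4) * (e ^ 2 / 4)) + 4 * e ^ 2 * ((e ^ 2 / 4) * 1)) / 300 ^ 2 := by
            have : ε ^ 2 ≤ 1 := by nlinarith
            gcongr
          _ ≤ 12 * (e ^ 4 / 300 ^ 2) := by nlinarith [pow_nonneg he0 4]
      have hB : 2 / (m : ℝ) * ∑ i, p i * ((p i - q i) * mixWeight q i) ^ 2 ≤ 3 * e ^ 4 / 300 := by
        calc 2 / (m : ℝ) * ∑ i, p i * ((p i - q i) * mixWeight q i) ^ 2
            ≤ 2 / (m : ℝ) * ((2 + 2 * (N * e)) * e ^ 2) := by gcongr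
          _ = 4 * (1 / m) * e ^ 2 + 4 * (N / m) * e ^ 3 := by ring
          _ ≤ 4 * (ε ^ 2 / 300) * e ^ 2 + 4 * (ε ^ 2 / 300) * e ^ 3 := by gcongr
          _ ≤ 4 * (e ^ 2 / 4 / 300) * e ^ 2 + 4 * (e / 2 / 300) * e ^ 3 := by gcongr
          _ = 3 * e ^ 4 / 300 := by ring
      nlinarith [pow_nonneg he0 4]
  · push_cast
    linarith

end ChiSquare

/-- upper bound for augmented identity testing:
there is an absolute constant `C > 0` such that for every `n`, `ε ∈ (0,1]`,
`α ∈ [0,1]`, known `q` and prediction `phat`, with `d := tv (q − phat)`, there is an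
`(α, ε, 0.1)`-augmented identity tester whose number of samples `s` satisfies
`s ≤ C·√n/ε²` if `d ≤ α`, and `s ≤ C·min(1/(d−α)², √n/ε²)` if `d > α`. -/
theorem stmt0 :
    ∃ C : ℝ, 0 < C ∧
      ∀ (n : ℕ) (ε α : ℝ), ε ∈ Set.Ioc (0:ℝ) 1 → α ∈ Set.Icc (0:ℝ) 1 →
        ∀ q phat : Fin n → ℝ, IsDist q → IsDist phat →
          ∃ (s : ℕ) (A : (Fin s → Fin n) → Outcome → ℝ),
            IsAugIdentityTester α ε 0.1 q phat A ∧
            (tv q phat ≤ α → (s : ℝ) ≤ C * Real.sqrt n / ε ^ 2) ∧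
            (α < tv q phat →
              (s : ℝ) ≤ C * min (1 / (tv q phat - α) ^ 2) (Real.sqrt n / ε ^ 2)) := by
  refine ⟨1000, by norm_num, fun n ε α hε hα q phat hq hphat => ?_⟩
  by_cases h : α < tv q phat ∧ 1 / (tv q phat - α) ^ 2 ≤ √n / ε ^ 2
  · obtain ⟨s, A, hA, hs⟩ := exists_tester_of_lt_tv (ε := ε) hq hphat hα.1 h.1
    exact ⟨s, A, hA, fun h' => absurd h.1 (not_lt.2 h'), fun _ => by rwa [min_eq_left h.2]⟩
  · obtain ⟨s, A, hA, hs⟩ := exists_identity_tester (α := α) (phat := phat) hε hq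
    refine ⟨s, A, hA, fun _ => by rwa [mul_div_assoc], fun h' => ?_⟩
    rwa [min_eq_right (not_le.1 fun hc => h ⟨h', hc⟩).le]
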